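/- arXiv:2602.16397 — 6 statements merged into one kernel-verified Lean document; each statement's English description precedes it below -/
import Mathlib

section
/- Let F be a field with a fixed algebraic closure F̄, let A be a finitely generated commutative F-algebra, and let G be a finite group acting on A by F-algebra automorphisms. Then the restriction map Hom_{F-alg}(A, F̄) → Hom_{F-alg}(A^G, F̄) is surjective, and two F-algebra homomorphisms φ, ψ : A → F̄ have the same restriction to A^G if and only if ψ = φ ∘ g for some g ∈ G. In other words, restriction induces a bijection from the set of G-orbits in Hom_{F-alg}(A, F̄) onto Hom_{F-alg}(A^G, F̄). -/
/-- The subalgebra of invariants of a group acting by `F`-algebra automorphisms. -/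
def invariantSubalgebra (F A : Type*) [CommSemiring F] [CommSemiring A] [Algebra F A]
    {G : Type*} [Group G] (ρ : G →* (A ≃ₐ[F] A)) : Subalgebra F A where
  carrier := {a | ∀ g : G, ρ g a = a}
  mul_mem' := fun {a b} ha hb g => by simp only [map_mul, ha g, hb g]
  add_mem' := fun {a b} ha hb g => by simp only [map_add, ha g, hb g]
  algebraMap_mem' := fun c g => by simp

open Polynomial in
/-- Two ring homomorphisms to a domain that agree on the invariants of a finite group action
are related, on any finite family of elements, by a single element of the group. -/
theorem exists_forall_eq_smul_of_eqOn_invariants {G A K : Type*} [Group G] [Finite G] [CommRing A]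
    [MulSemiringAction G A] [CommRing K] [IsDomain K] (φ ψ : A →+* K)
    (h : ∀ a : A, (∀ g : G, g • a = a) → φ a = ψ a) {n : ℕ} (a : Fin n → A) :
    ∃ g : G, ∀ i, ψ (a i) = φ (g • a i) := by
  cases nonempty_fintype G
  let p : A[X] := ∑ i : Fin n, monomial i (a i)
  have coeff_p (i : Fin n) : p.coeff i = a i := by
    simp [p, coeff_monomial, Fin.val_inj]
  have key : (MulSemiringAction.charpoly G p).map (mapRingHom φ) =
      (MulSemiringAction.charpoly G p).map (mapRingHom ψ) := by
    ext i j
    simp only [coeff_map, coe_mapRingHom]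
    refine h _ fun g => ?_
    rw [← Polynomial.coeff_smul, MulSemiringAction.smul_coeff_charpoly]
  have root : ((MulSemiringAction.charpoly G p).map (mapRingHom φ)).eval (p.map ψ) = 0 := by
    rw [key, ← coe_mapRingHom, eval_map_apply, MulSemiringAction.eval_charpoly, map_zero]
  rw [MulSemiringAction.charpoly_eq, Polynomial.map_prod, eval_prod,
    Finset.prod_eq_zero_iff] at root
  obtain ⟨g, -, hg⟩ := root
  refine ⟨g, fun i => ?_⟩
  simpa [sub_eq_zero, coeff_p] using congr_arg (fun q => q.coeff i) hg

/-- A homomorphism to an algebraically closed field extends along an injective integral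
extension of rings. -/
theorem nonempty_algHom_of_isIntegral_of_isAlgClosed (R S K : Type*) [CommRing R] [CommRing S]
    [Algebra R S] [FaithfulSMul R S] [Algebra.IsIntegral R S] [Field K] [IsAlgClosed K]
    [Algebra R K] : Nonempty (S →ₐ[R] K) := by
  let P : Ideal R := RingHom.ker (algebraMap R K)
  have : P.IsPrime := RingHom.ker_isPrime _
  obtain ⟨Q, -, hQ, hQP⟩ := Ideal.exists_ideal_over_prime_of_isIntegral P (⊥ : Ideal S) (by
    rw [← RingHom.ker_eq_comap_bot,
      (RingHom.injective_iff_ker_eq_bot _).mp (FaithfulSMul.algebraMap_injective R S)]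
    exact bot_le)
  have : Q.LiesOver P := ⟨hQP.symm⟩
  let f : R ⧸ P →+* K := RingHom.kerLift (algebraMap R K)
  let : Algebra (R ⧸ P) K := f.toAlgebra
  have : IsScalarTower R (R ⧸ P) K := .of_algebraMap_eq fun _ => rfl
  have : Module.IsTorsionFree (R ⧸ P) K :=
    Module.isTorsionFree_iff_algebraMap_injective.mpr (RingHom.kerLift_injective (algebraMap R K))
  have : Module.IsTorsionFree (R ⧸ P) (S ⧸ Q) :=
    Module.isTorsionFree_iff_faithfulSMul.mpr inferInstance
  let l : S ⧸ Q →ₐ[R ⧸ P] K := IsAlgClosed.lift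
  exact ⟨(l.restrictScalars R).comp (Ideal.Quotient.mkₐ R Q)⟩

/-- For a finite group `G` acting by `F`-algebra automorphisms on a finitely generated
commutative `F`-algebra `A`, restriction to the invariant subalgebra `A^G` gives a
surjection `Hom_{F-alg}(A, F̄) → Hom_{F-alg}(A^G, F̄)`, and two homomorphisms
`φ ψ : A → F̄` agree on `A^G` if and only if `ψ = φ ∘ g` for some `g ∈ G`.
Thus restriction induces a bijection of the `G`-orbits of `Hom_{F-alg}(A, F̄)` onto
`Hom_{F-alg}(A^G, F̄)`. -/
theorem orbits_of_points_biject_with_points_of_invariants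
    (F : Type*) [Field F] (A : Type*) [CommRing A] [Algebra F A]
    [Algebra.FiniteType F A]
    (G : Type*) [Group G] [Finite G] (ρ : G →* (A ≃ₐ[F] A)) :
    (∀ ψ : (invariantSubalgebra F A ρ) →ₐ[F] AlgebraicClosure F,
      ∃ φ : A →ₐ[F] AlgebraicClosure F, φ.comp (invariantSubalgebra F A ρ).val = ψ) ∧
    (∀ φ ψ : A →ₐ[F] AlgebraicClosure F,
      φ.comp (invariantSubalgebra F A ρ).val = ψ.comp (invariantSubalgebra F A ρ).val ↔
        ∃ g : G, ψ = φ.comp (ρ g).toAlgHom) := by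
  let : MulSemiringAction G A := MulSemiringAction.compHom A ρ
  refine ⟨fun ψ => ?_, fun φ ψ => ⟨fun h => ?_, ?_⟩⟩
  · let B := invariantSubalgebra F A ρ
    have : Algebra.IsInvariant B A G := ⟨fun a ha => ⟨⟨a, ha⟩, rfl⟩⟩
    have : Algebra.IsIntegral B A := Algebra.IsInvariant.isIntegral B A G
    let : Algebra B (AlgebraicClosure F) := ψ.toRingHom.toAlgebra
    have : IsScalarTower F B (AlgebraicClosure F) :=
      .of_algebraMap_eq fun c => (ψ.commutes c).symm
    obtain ⟨l⟩ := nonempty_algHom_of_isIntegral_of_isAlgClosed B A (AlgebraicClosure F)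
    exact ⟨l.restrictScalars F, AlgHom.ext l.commutes⟩
  · obtain ⟨n, f, hf⟩ := Algebra.FiniteType.iff_quotient_mvPolynomial''.mp
      (inferInstance : Algebra.FiniteType F A)
    obtain ⟨g, hg⟩ := exists_forall_eq_smul_of_eqOn_invariants (G := G) φ.toRingHom ψ.toRingHom
      (fun a ha => DFunLike.congr_fun h ⟨a, ha⟩) fun i => f (MvPolynomial.X i)
    exact ⟨g, (AlgHom.cancel_right hf).mp (MvPolynomial.algHom_ext hg)⟩
  · rintro ⟨g, rfl⟩
    exact AlgHom.ext fun a => congr_arg φ (a.2 g).symm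
end

section
/- Let G be a finite group acting by ring automorphisms on a commutative ring A, and let π : Spec A → Spec A^G be the continuous map induced by the inclusion A^G ⊆ A (sending a prime p of A to p ∩ A^G). Let U ⊆ Spec A be a G-stable open subset, i.e., g(p) ∈ U for every p ∈ U and g ∈ G. Then the image π(U) is open in Spec A^G and π⁻¹(π(U)) = U. -/
/-- The subring of invariants of a group acting by ring automorphisms on a
commutative ring `A`. -/
def fixedSubring (G A : Type*) [Group G] [CommRing A] [MulSemiringAction G A] : Subring A where
  carrier := {a | ∀ g : G, g • a = a}
  mul_mem' := fun {a b} ha hb g => by rw [smul_mul', ha g, hb g]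
  add_mem' := fun {a b} ha hb g => by rw [smul_add, ha g, hb g]
  one_mem' := fun g => smul_one g
  zero_mem' := fun g => smul_zero g
  neg_mem' := fun {a} ha g => by rw [smul_neg, ha g]

instance fixedSubring.isInvariant (G A : Type*) [Group G] [CommRing A] [MulSemiringAction G A] :
    Algebra.IsInvariant (fixedSubring G A) A G :=
  ⟨fun b hb => ⟨⟨b, hb⟩, rfl⟩⟩

instance fixedSubring.smulCommClass (G A : Type*) [Group G] [CommRing A]
    [MulSemiringAction G A] : SMulCommClass G (fixedSubring G A) A :=
  ⟨fun g a b => by rw [Subring.smul_def, Subring.smul_def, smul_eq_mul, smul_eq_mul, smul_mul',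
    a.2 g]⟩

/-- Primes with the same contraction to the invariant subring are conjugate under the group. -/
theorem fixedSubring.exists_comap_eq_of_comap_eq {G A : Type*} [Group G] [Finite G] [CommRing A]
    [MulSemiringAction G A] {p q : PrimeSpectrum A}
    (h : PrimeSpectrum.comap (fixedSubring G A).subtype p =
      PrimeSpectrum.comap (fixedSubring G A).subtype q) :
    ∃ g : G, q = PrimeSpectrum.comap (MulSemiringAction.toRingHom G A g) p := by
  obtain ⟨g, hg⟩ := Algebra.IsInvariant.exists_smul_of_under_eq (fixedSubring G A) A G
    p.asIdeal q.asIdeal (congrArg PrimeSpectrum.asIdeal h)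
  refine ⟨g⁻¹, PrimeSpectrum.ext ?_⟩
  rw [hg, Ideal.pointwise_smul_eq_comap]
  rfl

/-- Let a finite group `G` act by ring automorphisms on a commutative ring `A`, and let
`π : Spec A → Spec A^G` be induced by the inclusion `A^G ⊆ A`.  If `U ⊆ Spec A` is a
`G`-stable open subset, then `π(U)` is open in `Spec A^G` and `π⁻¹(π(U)) = U`. -/
theorem image_of_invariant_open_is_open_and_saturated
    (G A : Type*) [Group G] [Finite G] [CommRing A] [MulSemiringAction G A]
    (U : Set (PrimeSpectrum A)) (hU : IsOpen U)
    (hstable : ∀ p ∈ U, ∀ g : G,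
      PrimeSpectrum.comap (MulSemiringAction.toRingHom G A g) p ∈ U) :
    IsOpen (PrimeSpectrum.comap (fixedSubring G A).subtype '' U) ∧
      PrimeSpectrum.comap (fixedSubring G A).subtype ⁻¹'
        (PrimeSpectrum.comap (fixedSubring G A).subtype '' U) = U := by
  have saturated : PrimeSpectrum.comap (fixedSubring G A).subtype ⁻¹'
      (PrimeSpectrum.comap (fixedSubring G A).subtype '' U) = U := by
    refine (Set.subset_preimage_image _ _).antisymm' ?_
    rintro q ⟨p, hp, hpq⟩
    obtain ⟨g, rfl⟩ := fixedSubring.exists_comap_eq_of_comap_eq hpq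
    exact hstable p hp g
  have integral : (fixedSubring G A).subtype.IsIntegral :=
    (Algebra.IsInvariant.isIntegral (fixedSubring G A) A G).isIntegral
  have quotient : Topology.IsQuotientMap (PrimeSpectrum.comap (fixedSubring G A).subtype) :=
    (PrimeSpectrum.isClosedMap_comap_of_isIntegral _ integral).isQuotientMap
      (PrimeSpectrum.continuous_comap _)
      (integral.comap_surjective Subtype.val_injective)
  exact ⟨quotient.isOpen_preimage.mp (saturated.symm ▸ hU), saturated⟩
end

section
/- Let F be a field with a fixed algebraic closure F̄, and let A → B be a homomorphism of finitely generated commutative F-algebras such that F̄ ⊗_F B is an étale F̄ ⊗_F A-algebra. Then there exists a finite field extension E of F (contained in F̄) such that E ⊗_F B is an étale E ⊗_F A-algebra. -/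
open scoped TensorProduct

universe u

namespace RingHom

variable {R A B : Type u} (K : Type u) [CommRing R] [CommRing K] [CommRing A] [CommRing B]
  [Algebra R K] [Algebra R A] [Algebra R B]

/-- A homomorphism of `R`-algebras is étale if and only if its base change along a faithfully flat
`R`-algebra is étale. -/
lemma etale_tensorProductMap_iff [Module.FaithfullyFlat R K] (f : A →ₐ[R] B) :
    (Algebra.TensorProduct.map (AlgHom.id R K) f).toRingHom.Etale ↔ f.toRingHom.Etale := by
  let _ : Algebra A B := f.toRingHom.toAlgebra
  let _ : Algebra A (K ⊗[R] A) := Algebra.TensorProduct.rightAlgebra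
  let _ : Algebra B (K ⊗[R] B) := Algebra.TensorProduct.rightAlgebra
  let _ : Algebra (K ⊗[R] A) (K ⊗[R] B) :=
    (Algebra.TensorProduct.map (AlgHom.id R K) f).toRingHom.toAlgebra
  let _ : Algebra A (K ⊗[R] B) := ((algebraMap B (K ⊗[R] B)).comp (algebraMap A B)).toAlgebra
  have : IsScalarTower R A B := .of_algHom f
  have : IsScalarTower A B (K ⊗[R] B) := .of_algebraMap_eq' rfl
  have : IsScalarTower A (K ⊗[R] A) (K ⊗[R] B) := .of_algebraMap_eq fun a ↦
    (Algebra.TensorProduct.map_tmul (AlgHom.id R K) f 1 a).symm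
  have : IsScalarTower K (K ⊗[R] A) (K ⊗[R] B) := .of_algebraMap_eq fun k ↦ by
    simp [algebraMap_toAlgebra]
  have : IsScalarTower R A (K ⊗[R] B) := .to₁₂₄ R A B (K ⊗[R] B)
  have : Algebra.IsPushout A B (K ⊗[R] A) (K ⊗[R] B) :=
    (Algebra.IsPushout.comp_iff R A K (K ⊗[R] A)).mp inferInstance
  have hflat : (algebraMap A (K ⊗[R] A)).FaithfullyFlat :=
    FaithfullyFlat.isStableUnderBaseChange R K A (K ⊗[R] A)
      ((faithfullyFlat_algebraMap_iff).mpr inferInstance)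
  exact ⟨fun h ↦ Etale.codescendsAlong_faithfullyFlat (R' := K ⊗[R] A) (S' := K ⊗[R] B) hflat h,
    fun h ↦ Etale.isStableUnderBaseChange A B (K ⊗[R] A) (K ⊗[R] B) h⟩

end RingHom

/-- Let `F` be a field with algebraic closure `F̄`, and let `f : A → B` be a homomorphism
of finitely generated commutative `F`-algebras such that the base change
`F̄ ⊗[F] A → F̄ ⊗[F] B` is étale.  Then there is a finite field extension `E` of `F`
inside `F̄` such that `E ⊗[F] A → E ⊗[F] B` is already étale. -/
theorem etale_over_finite_subextension_of_etale_baseChange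
    (F : Type u) [Field F] (A B : Type u) [CommRing A] [CommRing B]
    [Algebra F A] [Algebra F B] [Algebra.FiniteType F A] [Algebra.FiniteType F B]
    (f : A →ₐ[F] B)
    (h : letI : Algebra (AlgebraicClosure F ⊗[F] A) (AlgebraicClosure F ⊗[F] B) :=
          (Algebra.TensorProduct.map (AlgHom.id F (AlgebraicClosure F)) f).toRingHom.toAlgebra
        Algebra.Etale (AlgebraicClosure F ⊗[F] A) (AlgebraicClosure F ⊗[F] B)) :
    ∃ E : IntermediateField F (AlgebraicClosure F), FiniteDimensional F E ∧
      (letI : Algebra (E ⊗[F] A) (E ⊗[F] B) :=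
          (Algebra.TensorProduct.map (AlgHom.id F E) f).toRingHom.toAlgebra;
        Algebra.Etale (E ⊗[F] A) (E ⊗[F] B)) := by
  have hf : f.toRingHom.Etale :=
    (RingHom.etale_tensorProductMap_iff (AlgebraicClosure F) f).mp h
  exact ⟨⊥, inferInstance, (RingHom.etale_tensorProductMap_iff _ f).mpr hf⟩
end

section
/- Let F be a field with a fixed algebraic closure F̄, let A be a reduced finitely generated commutative F-algebra, and let G be a finite group acting on A by F-algebra automorphisms such that the induced action of G on Hom_{F-alg}(A, F̄) (by precomposition with g⁻¹) is free, i.e., g·φ = φ for some φ implies g = 1. Then A is an étale A^G-algebra; in particular the quotient morphism Spec A → Spec A^G is étale. -/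
universe u v

open TensorProduct

section Galois

variable {B A G : Type*} [CommRing B] [CommRing A] [Algebra B A] [Group G]
  [MulSemiringAction G A] [SMulCommClass G B A]

/-- The algebra homomorphism `A ⊗[B] A → A` given by `x ⊗ y ↦ x * g • y`. -/
noncomputable def twistedMul (B A : Type*) {G : Type*} [CommRing B] [CommRing A] [Algebra B A]
    [Group G] [MulSemiringAction G A] [SMulCommClass G B A] (g : G) : A ⊗[B] A →ₐ[A] A :=
  Algebra.TensorProduct.lift (AlgHom.id A A) (MulSemiringAction.toAlgHom B A g)
    fun _ _ => Commute.all _ _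

@[simp]
theorem twistedMul_tmul (g : G) (x y : A) : twistedMul B A g (x ⊗ₜ y) = x * g • y := by
  simp [twistedMul]

theorem exists_twistedMul_eq_one_and_eq_zero {g : G}
    (hg : ∀ m : Ideal A, m.IsMaximal → ∃ a : A, a - g • a ∉ m) :
    ∃ t : A ⊗[B] A, twistedMul B A (1 : G) t = 1 ∧ twistedMul B A g t = 0 := by
  have hsurj : Function.Surjective (twistedMul B A (1 : G)) := fun a => ⟨a ⊗ₜ 1, by simp⟩
  have htop : (RingHom.ker (twistedMul B A g)).map (twistedMul B A (1 : G)) = ⊤ := by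
    by_contra hne
    obtain ⟨m, hm, hle⟩ := Ideal.exists_le_maximal _ hne
    obtain ⟨a, ha⟩ := hg m hm
    refine ha (hle ?_)
    have hker : (1 : A) ⊗ₜ[B] a - (g • a) ⊗ₜ[B] (1 : A) ∈ RingHom.ker (twistedMul B A g) := by
      simp [RingHom.mem_ker]
    simpa using Ideal.mem_map_of_mem (twistedMul B A (1 : G)) hker
  obtain ⟨t, ht, h1⟩ := (Ideal.mem_map_iff_of_surjective _ hsurj).mp
    (htop ▸ Submodule.mem_top : (1 : A) ∈ _)
  exact ⟨t, h1, ht⟩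

theorem exists_twistedMul_eq_ite [Finite G] [DecidableEq G]
    (h : ∀ g : G, g ≠ 1 → ∀ m : Ideal A, m.IsMaximal → ∃ a : A, a - g • a ∉ m) :
    ∃ t : A ⊗[B] A, ∀ g : G, twistedMul B A g t = if g = 1 then 1 else 0 := by
  have := Fintype.ofFinite G
  choose t ht1 ht0 using fun g : {g : G // g ≠ 1} =>
    exists_twistedMul_eq_one_and_eq_zero (B := B) (h g.1 g.2)
  refine ⟨∏ g, t g, fun g => ?_⟩
  rw [map_prod]
  split_ifs with hg
  · subst hg
    exact Finset.prod_eq_one fun g _ => ht1 g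
  · exact Finset.prod_eq_zero (Finset.mem_univ ⟨g, hg⟩) (ht0 ⟨g, hg⟩)

theorem exists_linearMap_algebraMap_eq_sum_smul [Fintype G] [FaithfulSMul B A]
    [Algebra.IsInvariant B A G] :
    ∃ tr : A →ₗ[B] B, ∀ a : A, algebraMap B A (tr a) = ∑ g : G, g • a := by
  have hinv (a : A) : ∃ b : B, algebraMap B A b = ∑ g : G, g • a := by
    refine Algebra.IsInvariant.isInvariant (G := G) _ fun g => ?_
    simp_rw [Finset.smul_sum, smul_smul]
    exact Fintype.sum_equiv (Equiv.mulLeft g) _ _ fun _ => rfl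
  choose tr htr using hinv
  have hinj := FaithfulSMul.algebraMap_injective B A
  refine ⟨⟨⟨tr, fun x y => hinj ?_⟩, fun b x => hinj ?_⟩, htr⟩
  · simp [htr, Finset.sum_add_distrib]
  · simp [htr, Finset.mul_sum, Algebra.smul_def, smul_mul', smul_algebraMap]

/-- If no nontrivial element of a finite group acting on `A` fixes a closed point of `Spec A` and
acts trivially on its residue field, then `A` is étale over its ring of invariants. -/
theorem Algebra.Etale.of_isInvariant [Finite G] [FaithfulSMul B A] [Algebra.IsInvariant B A G]
    (h : ∀ g : G, g ≠ 1 → ∀ m : Ideal A, m.IsMaximal → ∃ a : A, a - g • a ∉ m) :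
    Algebra.Etale B A := by
  classical
  have := Fintype.ofFinite G
  obtain ⟨t, ht⟩ := exists_twistedMul_eq_ite (B := B) h
  obtain ⟨tr, htr⟩ := exists_linearMap_algebraMap_eq_sum_smul (B := B) (A := A) (G := G)
  obtain ⟨n, x, y, rfl⟩ := TensorProduct.exists_sum_tmul_eq t
  simp only [map_sum, twistedMul_tmul] at ht
  have hx (a : A) : ∑ i, tr (y i * a) • x i = a := by
    calc ∑ i, tr (y i * a) • x i = ∑ g : G, (∑ i, x i * g • y i) * g • a := by
          simp only [Algebra.smul_def, htr, Finset.sum_mul]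
          rw [Finset.sum_comm]
          refine Finset.sum_congr rfl fun i _ => Finset.sum_congr rfl fun g _ => ?_
          rw [smul_mul']
          ring
      _ = a := by simp [ht]
  have hy (a : A) : ∑ i, tr (a * x i) • y i = a := by
    calc ∑ i, tr (a * x i) • y i = ∑ g : G, g • a * g • ∑ i, x i * g⁻¹ • y i := by
          simp only [Algebra.smul_def, htr, Finset.sum_mul, Finset.smul_sum, Finset.mul_sum]
          rw [Finset.sum_comm]
          refine Finset.sum_congr rfl fun i _ => Finset.sum_congr rfl fun g _ => ?_
          rw [smul_mul', smul_mul', smul_inv_smul]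
          ring
      _ = a := by simp [ht]
  let s : (Fin n → B) →ₗ[B] A := Fintype.linearCombination B x
  let i : A →ₗ[B] (Fin n → B) := LinearMap.pi fun j => tr ∘ₗ LinearMap.mulLeft B (y j)
  have hsi : s ∘ₗ i = LinearMap.id := by
    ext a
    simpa [s, i, Fintype.linearCombination_apply] using hx a
  have : Module.Projective B A := .of_split i s hsi
  have : Module.Finite B A := .of_surjective s fun a => ⟨i a, LinearMap.congr_fun hsi a⟩
  have : Module.FinitePresentation B A := Module.finitePresentation_of_projective B A
  have : Algebra.FormallyUnramified B A := by
    refine Algebra.FormallyUnramified.iff_exists_tensorProduct.mpr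
      ⟨∑ i, x i ⊗ₜ y i, fun a => ?_, by simpa using ht 1⟩
    simp only [Finset.mul_sum, sub_mul, Algebra.TensorProduct.tmul_mul_tmul, one_mul]
    rw [Finset.sum_sub_distrib, sub_eq_zero]
    calc ∑ j, x j ⊗ₜ[B] (a * y j)
        = ∑ j, x j ⊗ₜ[B] ∑ i, tr (a * y j * x i) • y i := by simp only [hy]
      _ = ∑ i, (∑ j, tr (y j * (a * x i)) • x j) ⊗ₜ[B] y i := by
          simp only [tmul_sum, sum_tmul, tmul_smul, smul_tmul']
          rw [Finset.sum_comm]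
          refine Finset.sum_congr rfl fun i _ => Finset.sum_congr rfl fun j _ => ?_
          rw [mul_comm a, mul_assoc]
      _ = ∑ i, (a * x i) ⊗ₜ[B] y i := by simp only [hx]
  exact .of_formallyUnramified_of_flat

end Galois

/-- Let `F` be a field with algebraic closure `F̄`, let `A` be a reduced finitely
generated commutative `F`-algebra, and let a finite group `G` act on `A` by `F`-algebra
automorphisms so that the induced action on the `F̄`-points `Hom_{F-alg}(A, F̄)` is free.
Then `A` is an étale `A^G`-algebra, i.e. `Spec A → Spec A^G` is étale. -/
theorem etale_over_invariants_of_free_action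
    (F : Type v) [Field F] (A : Type u) [CommRing A] [IsReduced A] [Algebra F A]
    [Algebra.FiniteType F A]
    (G : Type*) [Group G] [Finite G] (ρ : G →* (A ≃ₐ[F] A))
    (hfree : ∀ (g : G) (φ : A →ₐ[F] AlgebraicClosure F),
      φ.comp (ρ g).toAlgHom = φ → g = 1) :
    Algebra.Etale (invariantSubalgebra F A ρ) A := by
  let _ : MulSemiringAction G A := MulSemiringAction.compHom A ρ
  have hsmul (g : G) (a : A) : g • a = ρ g a := rfl
  have : SMulCommClass G (invariantSubalgebra F A ρ) A := ⟨fun g b a => by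
    simp only [hsmul, Algebra.smul_def, map_mul]
    congr 1
    exact b.2 g⟩
  have : Algebra.IsInvariant (invariantSubalgebra F A ρ) A G := ⟨fun a ha => ⟨⟨a, ha⟩, rfl⟩⟩
  refine Algebra.Etale.of_isInvariant (G := G) fun g hg m hm => ?_
  by_contra! hmem
  let _ := Ideal.Quotient.field m
  have : Module.Finite F (A ⧸ m) := finite_of_finite_type_of_isJacobsonRing F (A ⧸ m)
  let ψ : A ⧸ m →ₐ[F] AlgebraicClosure F := IsAlgClosed.lift
  refine hg (hfree g (ψ.comp (Ideal.Quotient.mkₐ F m)) (AlgHom.ext fun a => ?_))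
  exact congrArg ψ (Ideal.Quotient.eq.mpr (hmem a)).symm
end

section
/- Let A be a commutative Noetherian ring and let I₁, I₂ be ideals of A with I₁ + I₂ = A. Let c : A/(I₁ ∩ I₂) → A/I₁ × A/I₂ denote the Chinese remainder isomorphism. Then the A-linear map Hom_A(I₁, A/I₁) × Hom_A(I₂, A/I₂) → Hom_A(I₁ ∩ I₂, A/(I₁ ∩ I₂)) which sends a pair (ε₁, ε₂) to the homomorphism x ↦ c⁻¹(ε₁(x), ε₂(x)) is an isomorphism of A-modules. -/
/-- If `K ≤ I` are ideals, `M` is killed by `a`, and `b = 1 - a` multiplies `I` into `K`, then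
restriction from `I` to `K` is an isomorphism `Hom(I, M) ≃ Hom(K, M)`, with inverse
`ψ ↦ (x ↦ ψ (b x))`. -/
def Ideal.homRestrictEquiv {A M : Type*} [CommRing A] [AddCommGroup M] [Module A M]
    {K I : Ideal A} (hKI : K ≤ I) (a b : A) (hab : a + b = 1) (ha : ∀ m : M, a • m = 0)
    (hb : ∀ x ∈ I, b * x ∈ K) : (I →ₗ[A] M) ≃ₗ[A] (K →ₗ[A] M) :=
  have hbm (m : M) : b • m = m := by
    rw [← zero_add (b • m), ← ha m, ← add_smul, hab, one_smul]
  LinearEquiv.ofLinearMap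
    (LinearMap.lcomp A M (Submodule.inclusion hKI))
    (LinearMap.lcomp A M ((LinearMap.mulLeft A b).restrict hb))
    (by
      ext ψ x
      exact (map_smul ψ b x).trans (hbm _))
    (by
      ext ε x
      exact (map_smul ε b x).trans (hbm _))

/-- The Chinese remainder isomorphism `A/(I ∩ J) ≃ A/I × A/J` as an `A`-linear equivalence. -/
noncomputable def Ideal.quotientInfLinearEquivQuotientProd {A : Type*} [CommRing A] (I J : Ideal A)
    (h : IsCoprime I J) : (A ⧸ (I ⊓ J)) ≃ₗ[A] (A ⧸ I) × (A ⧸ J) :=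
  (Ideal.quotientInfEquivQuotientProd I J h).toAddEquiv.toLinearEquiv fun r x => by
    obtain ⟨x, rfl⟩ := Ideal.Quotient.mk_surjective x
    rfl


/-- Let `A` be a commutative Noetherian ring and `I₁, I₂` ideals with `I₁ + I₂ = A`,
and let `c : A/(I₁ ∩ I₂) ≃ A/I₁ × A/I₂` be the Chinese remainder isomorphism.  Then the
`A`-linear map `Hom_A(I₁, A/I₁) × Hom_A(I₂, A/I₂) → Hom_A(I₁ ∩ I₂, A/(I₁ ∩ I₂))`
sending `(ε₁, ε₂)` to `x ↦ c⁻¹(ε₁ x, ε₂ x)` is an isomorphism of `A`-modules. -/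
theorem hom_prod_equiv_hom_inf_of_coprime
    (A : Type*) [CommRing A] [IsNoetherianRing A] (I₁ I₂ : Ideal A)
    (h : I₁ ⊔ I₂ = ⊤) :
    ∃ Φ : ((↥I₁ →ₗ[A] A ⧸ I₁) × (↥I₂ →ₗ[A] A ⧸ I₂)) →ₗ[A]
        (↥(I₁ ⊓ I₂) →ₗ[A] A ⧸ (I₁ ⊓ I₂)),
      (∀ (ε : (↥I₁ →ₗ[A] A ⧸ I₁) × (↥I₂ →ₗ[A] A ⧸ I₂)) (x : ↥(I₁ ⊓ I₂)),
        Φ ε x = (Ideal.quotientInfEquivQuotientProd I₁ I₂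
            (Ideal.isCoprime_iff_sup_eq.mpr h)).symm
          (ε.1 ⟨x, (Submodule.mem_inf.mp x.2).1⟩, ε.2 ⟨x, (Submodule.mem_inf.mp x.2).2⟩)) ∧
      Function.Bijective Φ := by
  obtain ⟨a, ha, b, hb, hab⟩ := Submodule.mem_sup.mp ((Ideal.eq_top_iff_one _).mp h)
  have kill {I : Ideal A} {r : A} (hr : r ∈ I) (m : A ⧸ I) : r • m = 0 := by
    rw [Algebra.smul_def, Ideal.Quotient.algebraMap_eq, Ideal.Quotient.eq_zero_iff_mem.mpr hr,
      zero_mul]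
  let Φ :=
    (LinearEquiv.prodCongr
      (Ideal.homRestrictEquiv (inf_le_left : I₁ ⊓ I₂ ≤ I₁) a b hab (kill ha)
        fun x hx => ⟨I₁.mul_mem_left b hx, I₂.mul_mem_right x hb⟩)
      (Ideal.homRestrictEquiv (inf_le_right : I₁ ⊓ I₂ ≤ I₂) b a ((add_comm b a).trans hab) (kill hb)
        fun x hx => ⟨I₁.mul_mem_right x ha, I₂.mul_mem_left a hx⟩)) ≪≫ₗ
    LinearMap.prodEquiv A ≪≫ₗ
    (Ideal.quotientInfLinearEquivQuotientProd I₁ I₂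
      (Ideal.isCoprime_iff_sup_eq.mpr h)).symm.congrRight
  exact ⟨Φ.toLinearMap, fun _ _ => rfl, Φ.bijective⟩
end

section
/- Let F be a field with a fixed algebraic closure F̄, and let γ : Z₁ ⟶ Z₂ be a morphism of integral separated schemes of finite type over F. Assume that: (1) Z₂ is normal, i.e., every local ring of Z₂ is an integrally closed domain; (2) γ is birational, i.e., there exist dense open subschemes U₁ ⊆ Z₁ and U₂ ⊆ Z₂ such that γ restricts to an isomorphism from U₁ onto U₂; and (3) the induced map Z₁(F̄) → Z₂(F̄) on F̄-points is a bijection. Then γ is an isomorphism. -/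
open AlgebraicGeometry CategoryTheory Limits

theorem exists_lift_of_isClosed_singleton {X Y : Scheme} {K : Type} [Field K] [IsAlgClosed K]
    (f : X ⟶ Y) [LocallyOfFiniteType f] (q : Spec (.of K) ⟶ Y) (t : Spec (.of K)) {x : X}
    (hx : IsClosed {x}) (h : f x = q t) :
    ∃ p : Spec (.of K) ⟶ X, p ≫ f = q ∧ p t = x := by
  obtain ⟨z, hz, -⟩ := Scheme.Pullback.exists_preimage_pullback (f := f) (g := q) _ _ h
  have : JacobsonSpace ↥(pullback f q) := LocallyOfFiniteType.jacobsonSpace (pullback.snd f q)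
  obtain ⟨w, hw : pullback.fst f q w = x, hwc : IsClosed {w}⟩ :=
    nonempty_inter_closedPoints (Z := pullback.fst f q ⁻¹' {x}) ⟨z, hz⟩
    (hx.preimage (pullback.fst f q).continuous).isLocallyClosed
  refine ⟨pointOfClosedPoint (pullback.snd f q) w hwc ≫ pullback.fst f q, ?_, ?_⟩
  · rw [Category.assoc, pullback.condition, pointOfClosedPoint_comp_assoc]
  · rw [Scheme.Hom.comp_apply, pointOfClosedPoint_apply, hw]

theorem AlgebraicGeometry.IsAffineOpen.isIntegrallyClosed_of_stalk {X : Scheme}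
    [AlgebraicGeometry.IsIntegral X] (h : ∀ x : X, IsIntegrallyClosed (X.presheaf.stalk x))
    {U : X.Opens} (hU : IsAffineOpen U) [Nonempty U] : IsIntegrallyClosed Γ(X, U) := by
  refine .of_localization_maximal fun P _ hP ↦ ?_
  let p : Spec Γ(X, U) := ⟨P, hP.isPrime⟩
  let x : U := hU.isoSpec.inv p
  have hx : hU.primeIdealOf x = p := by
    change hU.isoSpec.hom (hU.isoSpec.inv p) = p
    rw [← Scheme.Hom.comp_apply, Iso.inv_hom_id]
    rfl
  let := X.presheaf.algebra_section_stalk x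
  have := hU.isLocalization_stalk x
  rw [hx] at this
  have := h x
  exact .of_equiv (IsLocalization.algEquiv P.primeCompl (X.presheaf.stalk x.1)
    (Localization.AtPrime P)).toRingEquiv

theorem exists_germ_eq_of_isIntegralElem {X : Scheme}
    [AlgebraicGeometry.IsIntegral X] {U : X.Opens} (hU : IsAffineOpen U) [Nonempty U]
    [IsIntegrallyClosed Γ(X, U)] {y : X} (hy : y = genericPoint X) (hyU : y ∈ U)
    {k : X.presheaf.stalk y} (hk : (X.presheaf.germ U y hyU).hom.IsIntegralElem k) :
    ∃ a, X.presheaf.germ U y hyU a = k := by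
  subst hy
  have := functionField_isFractionRing_of_isAffineOpen X U hU
  exact (IsIntegrallyClosed.isIntegral_iff (R := Γ(X, U)) (K := X.functionField)).mp hk

theorem AlgebraicGeometry.LocallyQuasiFinite.of_injOn_closedPoints {X Y : Scheme} (f : X ⟶ Y)
    [LocallyOfFiniteType f] [JacobsonSpace Y] (h : Set.InjOn f (closedPoints X)) :
    LocallyQuasiFinite f := by
  have : JacobsonSpace X := LocallyOfFiniteType.jacobsonSpace f
  rw [← Scheme.Hom.quasiFiniteLocus_eq_top_iff]
  by_contra H
  obtain ⟨x, hx, hxc⟩ := nonempty_inter_closedPoints (Z := (f.quasiFiniteLocus : Set X)ᶜ)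
    (Set.nonempty_compl.mpr fun e ↦ H (SetLike.coe_injective e))
    f.quasiFiniteLocus.2.isClosed_compl.isLocallyClosed
  refine hx (Scheme.Hom.quasiFiniteAt_iff_isOpen_singleton_asFiber.mpr ?_)
  have hcl : IsClosed {f x} := f.closePoints_subset_preimage_closedPoints hxc
  have hfib : f ⁻¹' {f x} = {x} := by
    refine subset_antisymm ?_ (by simp)
    have hZ : IsClosed (f ⁻¹' {f x}) := hcl.preimage f.continuous
    rw [← hZ.closure_eq, ← JacobsonSpace.closure_inter_closedPoints_eq_closure
      hZ.isLocallyClosed]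
    refine closure_minimal ?_ hxc
    rintro z ⟨hz, hzc⟩
    exact h hzc hxc hz
  have : Subsingleton (f ⁻¹' {f x}) := by rw [hfib]; infer_instance
  have : Subsingleton (f.fiber (f x)) := (f.fiberHomeo (f x)).subsingleton
  exact isOpen_discrete _

theorem AlgebraicGeometry.Scheme.Hom.bijOn_app_of_isIso_stalkMap_genericPoint {X Y : Scheme}
    [AlgebraicGeometry.IsIntegral X] [AlgebraicGeometry.IsIntegral Y]
    (f : X ⟶ Y) (hgen : f (genericPoint X) = genericPoint Y)
    [IsIso (f.stalkMap (genericPoint X))]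
    {U : Y.Opens} (hU : IsAffineOpen U) [Nonempty U] [IsIntegrallyClosed Γ(Y, U)] :
    Set.BijOn (f.app U) Set.univ {s | (f.app U).hom.IsIntegralElem s} := by
  have hξU : genericPoint X ∈ f ⁻¹ᵁ U := by
    change f (genericPoint X) ∈ U
    rw [hgen]
    exact ((genericPoint_spec Y).mem_open_set_iff U.isOpen).mpr (by simpa using ‹Nonempty U›)
  let g := X.presheaf.germ _ _ hξU
  let σ := f.stalkMap (genericPoint X)
  have hcomp : Y.presheaf.germ U _ hξU ≫ σ = f.app U ≫ g := f.germ_stalkMap U _ hξU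
  have hcomp' : Y.presheaf.germ U _ hξU = f.app U ≫ g ≫ inv σ := by
    rw [← Category.assoc, ← hcomp]; simp
  have hg : Function.Injective (g ≫ inv σ) := by
    rw [ConcreteCategory.coe_comp]
    exact (ConcreteCategory.bijective_of_isIso (inv σ)).injective.comp
      (germ_injective_of_isIntegral X _ hξU)
  refine ⟨fun a _ ↦ (f.app U).hom.isIntegralElem_map, Function.Injective.injOn ?_, fun s hs ↦ ?_⟩
  · have := germ_injective_of_isIntegral Y _ (show f (genericPoint X) ∈ U from hξU)
    rw [hcomp', ConcreteCategory.coe_comp] at this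
    exact this.of_comp
  · obtain ⟨a, ha⟩ := exists_germ_eq_of_isIntegralElem hU hgen hξU (k := (g ≫ inv σ) s) (by
      rw [hcomp']
      obtain ⟨p, hp, hp'⟩ := hs
      refine ⟨p, hp, ?_⟩
      have := congr((g ≫ inv σ).hom $hp')
      rwa [map_zero, Polynomial.hom_eval₂] at this)
    refine ⟨a, trivial, hg ?_⟩
    rw [← ha, hcomp']
    rfl

theorem isIso_of_isAffineHom_of_isIso_app {X Y : Scheme} (f : X ⟶ Y) [IsAffineHom f]
    (h : ∀ U : Y.affineOpens, IsIso (f.app U)) : IsIso f := by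
  refine (IsZariskiLocalAtTarget.iff_of_iSup_eq_top (P := .isomorphisms _) _
    (iSup_affineOpens_eq_top Y)).mpr fun U ↦ ?_
  have : IsAffine U.1 := U.2
  have : IsAffine (f ⁻¹ᵁ U.1) := U.2.preimage f
  have : IsIso (f ∣_ U.1).appTop := by
    have e : U.1.ι ''ᵁ ⊤ = U.1 := by simp
    have : IsIso (f.app (U.1.ι ''ᵁ ⊤)) := by rw [e]; exact h U
    rw [Scheme.Hom.appTop, morphismRestrict_app]
    exact IsIso.comp_isIso' this (Functor.map_isIso X.presheaf _)
  exact ((MorphismProperty.isomorphisms _).arrow_mk_iso_iff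
    (arrowIsoSpecΓOfIsAffine (f ∣_ U.1))).mpr
      (inferInstanceAs (IsIso (Spec.map (f ∣_ U.1).appTop)))

theorem isIso_fromNormalization {X Y : Scheme}
    [AlgebraicGeometry.IsIntegral X] [AlgebraicGeometry.IsIntegral Y]
    (f : X ⟶ Y) [QuasiCompact f] [QuasiSeparated f] (hgen : f (genericPoint X) = genericPoint Y)
    [IsIso (f.stalkMap (genericPoint X))]
    (h : ∀ y : Y, IsIntegrallyClosed (Y.presheaf.stalk y)) : IsIso f.fromNormalization := by
  refine isIso_of_isAffineHom_of_isIso_app _ fun U ↦ ?_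
  rw [f.fromNormalization_app U.2]
  let := (f.app U.1).hom.toAlgebra
  suffices IsIso (CommRingCat.ofHom
      (algebraMap Γ(Y, U.1) (integralClosure Γ(Y, U.1) Γ(X, f ⁻¹ᵁ U.1)))) from inferInstance
  rw [ConcreteCategory.isIso_iff_bijective]
  change Function.Bijective (algebraMap Γ(Y, U.1) (integralClosure Γ(Y, U.1) Γ(X, f ⁻¹ᵁ U.1)))
  obtain hne | hne := isEmpty_or_nonempty U.1
  · have : Subsingleton Γ(Y, U.1) := by
      rw [show U.1 = ⊥ from SetLike.coe_injective (Set.isEmpty_coe_sort.mp hne)]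
      infer_instance
    have := (algebraMap Γ(Y, U.1) (integralClosure Γ(Y, U.1) Γ(X, f ⁻¹ᵁ U.1))).codomain_trivial
    exact ⟨Function.injective_of_subsingleton _, Function.surjective_to_subsingleton _⟩
  have := U.2.isIntegrallyClosed_of_stalk h
  have H := Scheme.Hom.bijOn_app_of_isIso_stalkMap_genericPoint f hgen U.2
  refine ⟨fun a b hab ↦ H.injOn trivial trivial congr(($hab).1), fun ⟨s, hs⟩ ↦ ?_⟩
  obtain ⟨a, -, ha⟩ := H.surjOn hs
  exact ⟨a, Subtype.ext ha⟩

theorem isIso_stalkMap_of_isOpenImmersion_comp {U X Y : Scheme} (j : U ⟶ X) (f : X ⟶ Y)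
    [IsOpenImmersion j] [IsOpenImmersion (j ≫ f)] (u : U) : IsIso (f.stalkMap (j u)) := by
  have : IsIso (f.stalkMap (j u) ≫ j.stalkMap u) := by
    rw [← Scheme.Hom.stalkMap_comp]
    exact (inferInstance : IsIso ((j ≫ f).stalkMap u))
  exact IsIso.of_isIso_comp_right _ (j.stalkMap u)

theorem isOpenImmersion_of_locallyQuasiFinite_of_isIntegrallyClosed {U X Y : Scheme}
    [AlgebraicGeometry.IsIntegral X] [AlgebraicGeometry.IsIntegral Y]
    (j : U ⟶ X) (f : X ⟶ Y) [Nonempty U] [IsOpenImmersion j] [IsOpenImmersion (j ≫ f)]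
    [LocallyQuasiFinite f] [LocallyOfFiniteType f] [IsSeparated f] [QuasiCompact f]
    (h : ∀ y : Y, IsIntegrallyClosed (Y.presheaf.stalk y)) : IsOpenImmersion f := by
  have : AlgebraicGeometry.IsIntegral U := isIntegral_of_isOpenImmersion j
  have hj : j (genericPoint U) = genericPoint X := genericPoint_eq_of_isOpenImmersion j
  have hgen : f (genericPoint X) = genericPoint Y := by
    rw [← hj, ← Scheme.Hom.comp_apply, genericPoint_eq_of_isOpenImmersion]
  have : IsIso (f.stalkMap (genericPoint X)) := by
    rw [← hj]
    exact isIso_stalkMap_of_isOpenImmersion_comp j f _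
  have := isIso_fromNormalization f hgen h
  rw [← f.toNormalization_fromNormalization]
  infer_instance

/-- Let `F` be a field with algebraic closure `F̄`, and let `γ : Z₁ ⟶ Z₂` be a morphism
of integral separated schemes of finite type over `F`.  Assume that `Z₂` is normal
(all its local rings are integrally closed domains), that `γ` is birational (it restricts
to an isomorphism between dense open subschemes), and that `γ` induces a bijection
`Z₁(F̄) → Z₂(F̄)` on `F̄`-points.  Then `γ` is an isomorphism. -/
theorem isIso_of_birational_bijective_on_points_target_normal
    (F : Type) [Field F] (Z₁ Z₂ : Scheme)
    (s₁ : Z₁ ⟶ Spec (CommRingCat.of F)) (s₂ : Z₂ ⟶ Spec (CommRingCat.of F))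
    [AlgebraicGeometry.IsIntegral Z₁] [AlgebraicGeometry.IsIntegral Z₂]
    [AlgebraicGeometry.IsSeparated s₁] [AlgebraicGeometry.IsSeparated s₂]
    [LocallyOfFiniteType s₁] [QuasiCompact s₁]
    [LocallyOfFiniteType s₂] [QuasiCompact s₂]
    (γ : Z₁ ⟶ Z₂) (hγ : γ ≫ s₂ = s₁)
    (hnormal : ∀ x : Z₂, IsDomain (Z₂.presheaf.stalk x) ∧
      IsIntegrallyClosed (Z₂.presheaf.stalk x))
    (hbirational : ∃ (U₁ : Z₁.Opens) (U₂ : Z₂.Opens),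
      Dense (U₁ : Set Z₁) ∧ Dense (U₂ : Set Z₂) ∧
      ∃ e : U₁.toScheme ≅ U₂.toScheme, e.hom ≫ U₂.ι = U₁.ι ≫ γ)
    (hbij : Function.Bijective
      (fun p : {p : Spec (CommRingCat.of (AlgebraicClosure F)) ⟶ Z₁ //
            p ≫ s₁ = Spec.map (CommRingCat.ofHom (algebraMap F (AlgebraicClosure F)))} =>
        (⟨p.1 ≫ γ, by rw [Category.assoc, hγ]; exact p.2⟩ :
          {q : Spec (CommRingCat.of (AlgebraicClosure F)) ⟶ Z₂ //
            q ≫ s₂ = Spec.map (CommRingCat.ofHom (algebraMap F (AlgebraicClosure F)))}))) :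
    IsIso γ := by
  have hlft : LocallyOfFiniteType (γ ≫ s₂) := hγ ▸ inferInstance
  have hqc : QuasiCompact (γ ≫ s₂) := hγ ▸ inferInstance
  have hsep : AlgebraicGeometry.IsSeparated (γ ≫ s₂) := hγ ▸ inferInstance
  have : LocallyOfFiniteType γ := locallyOfFiniteType_of_comp γ s₂
  have : QuasiCompact γ := .of_comp γ s₂
  have : AlgebraicGeometry.IsSeparated γ := .of_comp γ s₂
  have : JacobsonSpace Z₂ := LocallyOfFiniteType.jacobsonSpace s₂
  let b := Spec.map (CommRingCat.ofHom (algebraMap F (AlgebraicClosure F)))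
  let t : Spec (.of (AlgebraicClosure F)) := IsLocalRing.closedPoint (AlgebraicClosure F)
  have hpt (y : Z₂) (hy : IsClosed {y}) : ∃ q : Spec (.of (AlgebraicClosure F)) ⟶ Z₂,
      q ≫ s₂ = b ∧ q t = y :=
    exists_lift_of_isClosed_singleton s₂ b t hy (Subsingleton.elim _ _)
  have hlift (x : Z₁) (hx : IsClosed {x}) (q : Spec (.of (AlgebraicClosure F)) ⟶ Z₂)
      (h : γ x = q t) :=
    exists_lift_of_isClosed_singleton γ q t hx h
  have hinj : Set.InjOn γ (closedPoints Z₁) := by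
    intro x hx x' hx' hxx'
    obtain ⟨q, hq, hqy⟩ := hpt (γ x) (γ.closePoints_subset_preimage_closedPoints hx)
    obtain ⟨p, hp, rfl⟩ := hlift x hx q hqy.symm
    obtain ⟨p', hp', rfl⟩ := hlift x' hx' q (hxx'.symm.trans hqy.symm)
    have hps : p ≫ s₁ = b := by rw [← hγ, reassoc_of% hp, hq]
    have hps' : p' ≫ s₁ = b := by rw [← hγ, reassoc_of% hp', hq]
    have := hbij.1 (a₁ := ⟨p, hps⟩) (a₂ := ⟨p', hps'⟩) (Subtype.ext (hp.trans hp'.symm))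
    rw [show p = p' from congrArg Subtype.val this]
  have : LocallyQuasiFinite γ := LocallyQuasiFinite.of_injOn_closedPoints γ hinj
  obtain ⟨U₁, U₂, hU₁, -, e, he⟩ := hbirational
  have : Nonempty U₁ := hU₁.nonempty.to_subtype
  have : IsOpenImmersion (U₁.ι ≫ γ) := he ▸ inferInstance
  have : IsOpenImmersion γ := isOpenImmersion_of_locallyQuasiFinite_of_isIntegrallyClosed
    U₁.ι γ fun y ↦ (hnormal y).2
  refine (isIso_iff_isOpenImmersion_and_surjective γ).mpr ⟨this, ⟨?_⟩⟩
  by_contra H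
  obtain ⟨y, hy, hyc⟩ := nonempty_inter_closedPoints (Z := (Set.range γ)ᶜ)
    (Set.nonempty_compl.mpr fun e ↦ H (Set.range_eq_univ.mp e))
    γ.isOpenEmbedding.isOpen_range.isClosed_compl.isLocallyClosed
  obtain ⟨q, hq, rfl⟩ := hpt y hyc
  obtain ⟨⟨p, hp⟩, hpq⟩ := hbij.2 ⟨q, hq⟩
  refine hy ⟨p t, ?_⟩
  rw [← Scheme.Hom.comp_apply, show p ≫ γ = q from congrArg Subtype.val hpq]
end
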